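/- Fix x, y ∈ ℝ^N and σ ∈ G. Then d(x,y) = ‖x − σ(y)‖ if and only if σ(y) and x belong to a common closed Weyl chamber, i.e., there exists a closed Weyl chamber containing both x and σ(y). -/

import Mathlib

open scoped RealInnerProductSpace ENNReal
open MeasureTheory Filter Topology

noncomputable section

/-- The reflection `σ_α(x) = x − 2(⟨x,α⟩/‖α‖²)α` in the hyperplane orthogonal to `α`. -/
def dunklReflection {N : ℕ} (α x : EuclideanSpace ℝ (Fin N)) : EuclideanSpace ℝ (Fin N) :=
  x - (2 * ⟪x, α⟫ / ‖α‖ ^ 2) • α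

/-- `R` is a normalized root system: `R ∩ ℝα = {α, −α}`, `σ_α(R) = R`, `‖α‖ = √2`
for every `α ∈ R` (and `0 ∉ R`). -/
def IsNormalizedRootSystem {N : ℕ} (R : Finset (EuclideanSpace ℝ (Fin N))) : Prop :=
  (0 : EuclideanSpace ℝ (Fin N)) ∉ R ∧
  (∀ α ∈ R, ∀ β ∈ R, (∃ c : ℝ, β = c • α) → β = α ∨ β = -α) ∧
  (∀ α ∈ R, -α ∈ R) ∧
  (∀ α ∈ R, dunklReflection α '' (R : Set (EuclideanSpace ℝ (Fin N)))
      = (R : Set (EuclideanSpace ℝ (Fin N)))) ∧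
  (∀ α ∈ R, ‖α‖ = Real.sqrt 2)

/-- The group `G` generated by the reflections `σ_α`, `α ∈ R`, viewed as a subgroup of the
orthogonal group (group of linear isometries) of `ℝ^N`. -/
def reflGroup {N : ℕ} (R : Finset (EuclideanSpace ℝ (Fin N))) :
    Subgroup (EuclideanSpace ℝ (Fin N) ≃ₗᵢ[ℝ] EuclideanSpace ℝ (Fin N)) :=
  Subgroup.closure {g | ∃ α ∈ R, ∀ x, g x = dunklReflection α x}

/-- The orbit distance `d(x,y) = min {‖x − σ(y)‖ : σ ∈ G}`. -/
def orbitDist {N : ℕ} (R : Finset (EuclideanSpace ℝ (Fin N)))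
    (x y : EuclideanSpace ℝ (Fin N)) : ℝ :=
  sInf {r | ∃ σ ∈ reflGroup R, r = ‖x - σ y‖}

/-- `σ_𝛂 = σ_{α_m} ∘ ⋯ ∘ σ_{α_1}` for `𝛂 = (α_1, …, α_m)`. -/
def reflSeq {N : ℕ} : List (EuclideanSpace ℝ (Fin N)) → EuclideanSpace ℝ (Fin N) →
    EuclideanSpace ℝ (Fin N)
  | [], y => y
  | a :: l, y => reflSeq l (dunklReflection a y)

/-- `ρ_𝛂(x,y,t) = ∏_{j=0}^{m−1} (1 + ‖x − σ_{α_j}∘⋯∘σ_{α_1}(y)‖/√t)^{−2}`. -/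
def rhoSeq {N : ℕ} (x : EuclideanSpace ℝ (Fin N)) (t : ℝ) :
    List (EuclideanSpace ℝ (Fin N)) → EuclideanSpace ℝ (Fin N) → ℝ
  | [], _ => 1
  | a :: l, y => ((1 + ‖x - y‖ / Real.sqrt t) ^ 2)⁻¹ * rhoSeq x t l (dunklReflection a y)

/-- `𝛂` is admissible for `(x,y)`: `d(x, σ_𝛂(y)) = ‖x − σ_𝛂(y)‖`. -/
def IsAdmissible {N : ℕ} (R : Finset (EuclideanSpace ℝ (Fin N)))
    (x y : EuclideanSpace ℝ (Fin N)) (l : List (EuclideanSpace ℝ (Fin N))) : Prop :=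
  orbitDist R x (reflSeq l y) = ‖x - reflSeq l y‖

/-- `Λ_B(x,y,t) = Σ_{𝛂 ∈ 𝒜(x,y), ℓ(𝛂) ≤ B} ρ_𝛂(x,y,t)` (a finite sum, written as a `tsum`
over the finite type of admissible sequences of roots of length at most `B`). -/
def LambdaFn {N : ℕ} (R : Finset (EuclideanSpace ℝ (Fin N))) (B : ℕ)
    (x y : EuclideanSpace ℝ (Fin N)) (t : ℝ) : ℝ :=
  ∑' l : {l : List (EuclideanSpace ℝ (Fin N)) //
      (∀ a ∈ l, a ∈ R) ∧ l.length ≤ B ∧ IsAdmissible R x y l},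
    rhoSeq x t l.1 y

/-- The density `w(x) = ∏_{α∈R} |⟨x,α⟩|^{k(α)}`. -/
def wDensity {N : ℕ} (R : Finset (EuclideanSpace ℝ (Fin N)))
    (k : EuclideanSpace ℝ (Fin N) → ℝ) (x : EuclideanSpace ℝ (Fin N)) : ℝ :=
  ∏ α ∈ R, |⟪x, α⟫| ^ (k α)

/-- The measure `dw(x) = w(x) dx`. -/
def wMeasure {N : ℕ} (R : Finset (EuclideanSpace ℝ (Fin N)))
    (k : EuclideanSpace ℝ (Fin N) → ℝ) : Measure (EuclideanSpace ℝ (Fin N)) :=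
  volume.withDensity fun x => ENNReal.ofReal (wDensity R k x)

namespace ReflectionGroup

section

variable {N : ℕ} {R Δ : Finset (EuclideanSpace ℝ (Fin N))} {z : EuclideanSpace ℝ (Fin N)}

/-- The reflection in the hyperplane orthogonal to `α`, as a linear isometry. -/
def refl (α : EuclideanSpace ℝ (Fin N)) :
    EuclideanSpace ℝ (Fin N) ≃ₗᵢ[ℝ] EuclideanSpace ℝ (Fin N) :=
  (ℝ ∙ α)ᗮ.reflection

lemma refl_apply (α v : EuclideanSpace ℝ (Fin N)) : refl α v = dunklReflection α v := by
  rw [refl, Submodule.reflection_orthogonal_apply, Submodule.reflection_singleton_apply,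
    dunklReflection, real_inner_comm]
  simp only [RCLike.ofReal_real_eq_id, id, neg_sub]
  module

lemma refl_mul_self (α : EuclideanSpace ℝ (Fin N)) : refl α * refl α = 1 := by
  ext1 v
  simp [refl]

lemma refl_inv (α : EuclideanSpace ℝ (Fin N)) : (refl α)⁻¹ = refl α :=
  inv_eq_of_mul_eq_one_left (refl_mul_self α)

lemma refl_neg (α : EuclideanSpace ℝ (Fin N)) : refl (-α) = refl α := by
  ext1 v
  rw [refl_apply, refl_apply, dunklReflection, dunklReflection, norm_neg, inner_neg_right]
  module

lemma refl_map (g : EuclideanSpace ℝ (Fin N) ≃ₗᵢ[ℝ] EuclideanSpace ℝ (Fin N))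
    (α : EuclideanSpace ℝ (Fin N)) : refl (g α) = g * refl α * g⁻¹ := by
  ext1 v
  obtain ⟨w, rfl⟩ := g.surjective v
  simp [refl_apply, dunklReflection]

lemma reflGroup_eq_closure :
    reflGroup R = Subgroup.closure (refl '' (R : Set (EuclideanSpace ℝ (Fin N)))) := by
  rw [reflGroup]
  congr 1
  ext g
  constructor
  · rintro ⟨α, hα, h⟩
    exact ⟨α, hα, by ext1 v; rw [h, refl_apply]⟩
  · rintro ⟨α, hα, rfl⟩
    exact ⟨α, hα, refl_apply α⟩

lemma refl_mem_reflGroup {α : EuclideanSpace ℝ (Fin N)} (hα : α ∈ R) : refl α ∈ reflGroup R := by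
  rw [reflGroup_eq_closure]
  exact Subgroup.subset_closure ⟨α, hα, rfl⟩

lemma inner_self_eq_two (hR : IsNormalizedRootSystem R) {α : EuclideanSpace ℝ (Fin N)}
    (hα : α ∈ R) : ⟪α, α⟫ = 2 := by
  rw [real_inner_self_eq_norm_sq, hR.2.2.2.2 α hα, Real.sq_sqrt zero_le_two]

lemma refl_apply_root (hR : IsNormalizedRootSystem R) {α : EuclideanSpace ℝ (Fin N)}
    (hα : α ∈ R) (v : EuclideanSpace ℝ (Fin N)) : refl α v = v - ⟪v, α⟫ • α := by
  rw [refl_apply, dunklReflection, ← real_inner_self_eq_norm_sq, inner_self_eq_two hR hα]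
  congr 2
  ring

lemma refl_mem (hR : IsNormalizedRootSystem R) {α β : EuclideanSpace ℝ (Fin N)}
    (hα : α ∈ R) (hβ : β ∈ R) : refl α β ∈ R := by
  have h : dunklReflection α β ∈ dunklReflection α '' (R : Set (EuclideanSpace ℝ (Fin N))) :=
    ⟨β, hβ, rfl⟩
  rw [hR.2.2.2.1 α hα] at h
  rw [refl_apply]
  exact h

variable (R z) in
/-- The roots that pair positively with `z`. -/
def posRoots : Finset (EuclideanSpace ℝ (Fin N)) := R.filter fun α => 0 < ⟪z, α⟫

lemma mem_posRoots {α : EuclideanSpace ℝ (Fin N)} :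
    α ∈ posRoots R z ↔ α ∈ R ∧ 0 < ⟪z, α⟫ := by
  simp [posRoots]

lemma neg_mem_posRoots (hR : IsNormalizedRootSystem R) (hz : ∀ α ∈ R, ⟪z, α⟫ ≠ 0)
    {α : EuclideanSpace ℝ (Fin N)} (hα : α ∈ R) (h : α ∉ posRoots R z) :
    -α ∈ posRoots R z := by
  rw [mem_posRoots] at h ⊢
  have h0 := hz α hα
  refine ⟨hR.2.2.1 α hα, ?_⟩
  rw [inner_neg_right]
  have : ¬ 0 < ⟪z, α⟫ := fun h' => h ⟨hα, h'⟩
  have := lt_of_le_of_ne (not_lt.1 this) h0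
  linarith

lemma eq_of_mem_posRoots_of_eq_smul (hR : IsNormalizedRootSystem R)
    {α β : EuclideanSpace ℝ (Fin N)} (hα : α ∈ posRoots R z) (hβ : β ∈ posRoots R z) {c : ℝ}
    (h : β = c • α) : β = α := by
  rw [mem_posRoots] at hα hβ
  refine (hR.2.1 α hα.1 β hβ.1 ⟨c, h⟩).resolve_right fun h' => ?_
  have := hβ.2
  rw [h', inner_neg_right] at this
  linarith [hα.2]

/-- `v` is a combination of elements of `Δ` with nonnegative coefficients. -/
def InCone (Δ : Finset (EuclideanSpace ℝ (Fin N))) (v : EuclideanSpace ℝ (Fin N)) : Prop :=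
  ∃ c : EuclideanSpace ℝ (Fin N) → ℝ, (∀ δ, 0 ≤ c δ) ∧ v = ∑ δ ∈ Δ, c δ • δ

lemma inCone_of_mem {v : EuclideanSpace ℝ (Fin N)} (hv : v ∈ Δ) : InCone Δ v := by
  classical
  refine ⟨fun δ => if δ = v then 1 else 0, fun δ => ?_, ?_⟩
  · positivity
  · simp [ite_smul, hv]

/-- `Δ` is a minimal set of positive roots whose cone contains all positive roots. -/
def IsSimpleSystem (R : Finset (EuclideanSpace ℝ (Fin N))) (z : EuclideanSpace ℝ (Fin N))
    (Δ : Finset (EuclideanSpace ℝ (Fin N))) : Prop :=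
  Minimal (fun S => S ⊆ posRoots R z ∧ ∀ β ∈ posRoots R z, InCone S β) Δ

variable (R z) in
lemma exists_isSimpleSystem : ∃ Δ, IsSimpleSystem R z Δ :=
  exists_minimal_of_wellFoundedLT _ ⟨posRoots R z, subset_rfl, fun _ => inCone_of_mem⟩

lemma IsSimpleSystem.mem_posRoots (hΔ : IsSimpleSystem R z Δ) {α : EuclideanSpace ℝ (Fin N)}
    (hα : α ∈ Δ) : α ∈ posRoots R z :=
  hΔ.prop.1 hα

lemma IsSimpleSystem.not_inCone_erase [DecidableEq (EuclideanSpace ℝ (Fin N))]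
    (hΔ : IsSimpleSystem R z Δ) {α : EuclideanSpace ℝ (Fin N)} (hα : α ∈ Δ) :
    ¬ InCone (Δ.erase α) α := by
  rintro ⟨e, he, heα⟩
  have h : Δ ≤ Δ.erase α := by
    refine hΔ.le_of_le ⟨(Finset.erase_subset _ _).trans hΔ.prop.1, fun β hβ => ?_⟩
      (Finset.erase_subset _ _)
    obtain ⟨c, hc, hcβ⟩ := hΔ.prop.2 β hβ
    refine ⟨fun δ => c α * e δ + c δ, fun δ => add_nonneg (mul_nonneg (hc _) (he _)) (hc _), ?_⟩
    rw [hcβ, ← Finset.add_sum_erase _ _ hα]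
    simp only [add_smul, Finset.sum_add_distrib, mul_smul, ← Finset.smul_sum, ← heα]
  exact Finset.notMem_erase α Δ (h hα)

lemma IsSimpleSystem.refl_mem_posRoots (hΔ : IsSimpleSystem R z Δ)
    (hR : IsNormalizedRootSystem R) (hz : ∀ α ∈ R, ⟪z, α⟫ ≠ 0) {α γ : EuclideanSpace ℝ (Fin N)}
    (hα : α ∈ Δ) (hγ : γ ∈ posRoots R z) (hne : γ ≠ α) : refl α γ ∈ posRoots R z := by
  classical
  have hαP := hΔ.mem_posRoots hα
  have hαR := (ReflectionGroup.mem_posRoots.1 hαP).1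
  by_contra hneg
  have hnegP := neg_mem_posRoots hR hz
    (refl_mem hR hαR (ReflectionGroup.mem_posRoots.1 hγ).1) hneg
  obtain ⟨c, hc, hcγ⟩ := hΔ.prop.2 γ hγ
  obtain ⟨d, hd, hdγ⟩ := hΔ.prop.2 _ hnegP
  rw [refl_apply_root hR hαR] at hdγ
  rw [← Finset.add_sum_erase _ _ hα] at hcγ hdγ
  set m : ℝ := ⟪γ, α⟫ - c α - d α with hm
  have hsum : ∑ δ ∈ Δ.erase α, (c δ + d δ) • δ = m • α := by
    simp only [add_smul, Finset.sum_add_distrib]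
    rw [← sub_eq_iff_eq_add'.2 hcγ, ← sub_eq_iff_eq_add'.2 hdγ, hm]
    module
  rcases le_or_gt m 0 with h0 | h0
  · have hz' := congrArg (fun v => ⟪z, v⟫) hsum
    simp only [inner_sum, inner_smul_right] at hz'
    have hnn : ∀ δ ∈ Δ.erase α, 0 ≤ (c δ + d δ) * ⟪z, δ⟫ := fun δ hδ =>
      mul_nonneg (add_nonneg (hc δ) (hd δ))
        (ReflectionGroup.mem_posRoots.1 (hΔ.mem_posRoots (Finset.mem_of_mem_erase hδ))).2.le
    have hle : m * ⟪z, α⟫ ≤ 0 :=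
      mul_nonpos_of_nonpos_of_nonneg h0 (ReflectionGroup.mem_posRoots.1 hαP).2.le
    have hzero := (Finset.sum_eq_zero_iff_of_nonneg hnn).1
      (le_antisymm (hz'.trans_le hle) (Finset.sum_nonneg hnn))
    have hc0 : ∀ δ ∈ Δ.erase α, c δ • δ = 0 := fun δ hδ => by
      have hpos := (ReflectionGroup.mem_posRoots.1
        (hΔ.mem_posRoots (Finset.mem_of_mem_erase hδ))).2
      have h1 := (mul_eq_zero.1 (hzero δ hδ)).resolve_right hpos.ne'
      have h2 : c δ = 0 := by linarith [hc δ, hd δ]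
      rw [h2, zero_smul]
    rw [Finset.sum_eq_zero hc0, add_zero] at hcγ
    exact hne (eq_of_mem_posRoots_of_eq_smul hR hαP hγ hcγ)
  · refine hΔ.not_inCone_erase hα ⟨fun δ => m⁻¹ * (c δ + d δ), fun δ =>
      mul_nonneg (inv_nonneg.2 h0.le) (add_nonneg (hc δ) (hd δ)), ?_⟩
    simp only [mul_smul, ← Finset.smul_sum, hsum]
    rw [smul_smul, inv_mul_cancel₀ h0.ne', one_smul]

lemma IsSimpleSystem.exists_inner_pos (hΔ : IsSimpleSystem R z Δ)
    (hR : IsNormalizedRootSystem R) {β : EuclideanSpace ℝ (Fin N)} (hβ : β ∈ posRoots R z) :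
    ∃ α ∈ Δ, 0 < ⟪β, α⟫ := by
  by_contra! h
  obtain ⟨c, hc, hcβ⟩ := hΔ.prop.2 β hβ
  have h2 := inner_self_eq_two hR (ReflectionGroup.mem_posRoots.1 hβ).1
  nth_rw 2 [hcβ] at h2
  simp only [inner_sum, inner_smul_right] at h2
  have := Finset.sum_nonpos fun δ hδ => mul_nonpos_of_nonneg_of_nonpos (hc δ) (h δ hδ)
  linarith

lemma IsSimpleSystem.refl_mem_closure (hΔ : IsSimpleSystem R z Δ)
    (hR : IsNormalizedRootSystem R) (hz : ∀ α ∈ R, ⟪z, α⟫ ≠ 0) {β : EuclideanSpace ℝ (Fin N)}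
    (hβ : β ∈ posRoots R z) :
    refl β ∈ Subgroup.closure (refl '' (Δ : Set (EuclideanSpace ℝ (Fin N)))) := by
  classical
  by_contra hbad
  set H := Subgroup.closure (refl '' (Δ : Set (EuclideanSpace ℝ (Fin N))))
  obtain ⟨β, hβ, hmin⟩ := Finset.exists_min_image
    ((posRoots R z).filter fun β => refl β ∉ H) (fun β => ⟪z, β⟫)
    ⟨β, Finset.mem_filter.2 ⟨hβ, hbad⟩⟩
  obtain ⟨hβP, hβH⟩ := Finset.mem_filter.1 hβ
  obtain ⟨α, hα, hpos⟩ := hΔ.exists_inner_pos hR hβP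
  have hαH : refl α ∈ H := Subgroup.subset_closure ⟨α, hα, rfl⟩
  have hne : β ≠ α := by
    rintro rfl
    exact hβH hαH
  have hαP := ReflectionGroup.mem_posRoots.1 (hΔ.mem_posRoots hα)
  have hγP := hΔ.refl_mem_posRoots hR hz hα hβP hne
  by_cases hγ : refl (refl α β) ∈ H
  · rw [refl_map, refl_inv] at hγ
    exact hβH ((H.mul_mem_cancel_left hαH).1 ((H.mul_mem_cancel_right hαH).1 hγ))
  · have := hmin _ (Finset.mem_filter.2 ⟨hγP, hγ⟩)
    rw [refl_apply_root hR hαP.1, inner_sub_right, inner_smul_right] at this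
    linarith [mul_pos hpos hαP.2]

lemma IsSimpleSystem.exists_word (hΔ : IsSimpleSystem R z Δ) (hR : IsNormalizedRootSystem R)
    (hz : ∀ α ∈ R, ⟪z, α⟫ ≠ 0)
    {g : EuclideanSpace ℝ (Fin N) ≃ₗᵢ[ℝ] EuclideanSpace ℝ (Fin N)} (hg : g ∈ reflGroup R) :
    ∃ l : List (EuclideanSpace ℝ (Fin N)), (∀ α ∈ l, α ∈ Δ) ∧ g = (l.map refl).prod := by
  have hle : reflGroup R ≤ Subgroup.closure (refl '' (Δ : Set (EuclideanSpace ℝ (Fin N)))) := by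
    rw [reflGroup_eq_closure, Subgroup.closure_le]
    rintro _ ⟨β, hβ, rfl⟩
    by_cases h : β ∈ posRoots R z
    · exact hΔ.refl_mem_closure hR hz h
    · rw [← refl_neg]
      exact hΔ.refl_mem_closure hR hz (neg_mem_posRoots hR hz hβ h)
  replace hg := hle hg
  clear hle
  induction hg using Subgroup.closure_induction with
  | mem g hg =>
    obtain ⟨α, hα, rfl⟩ := hg
    exact ⟨[α], by simpa using hα, by simp⟩
  | one => exact ⟨[], by simp, by simp⟩
  | mul g h _ _ ihg ihh =>
    obtain ⟨l, hl, rfl⟩ := ihg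
    obtain ⟨l', hl', rfl⟩ := ihh
    refine ⟨l ++ l', fun α hα => ?_, by simp⟩
    exact (List.mem_append.1 hα).elim (hl α) (hl' α)
  | inv g _ ih =>
    obtain ⟨l, hl, rfl⟩ := ih
    refine ⟨l.reverse, fun α hα => hl α (List.mem_reverse.1 hα), ?_⟩
    rw [List.prod_inv_reverse, List.map_map, List.map_reverse]
    congr 3

lemma IsSimpleSystem.exchange (hΔ : IsSimpleSystem R z Δ) (hR : IsNormalizedRootSystem R)
    (hz : ∀ α ∈ R, ⟪z, α⟫ ≠ 0) {β : EuclideanSpace ℝ (Fin N)} (hβ : β ∈ posRoots R z)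
    (l : List (EuclideanSpace ℝ (Fin N))) (hl : ∀ α ∈ l, α ∈ Δ)
    (h : (l.map refl).prod β ∉ posRoots R z) :
    ∃ l' : List (EuclideanSpace ℝ (Fin N)), (∀ α ∈ l', α ∈ Δ) ∧ l'.length + 1 = l.length ∧
      (l.map refl).prod * refl β = (l'.map refl).prod := by
  induction l with
  | nil => exact absurd hβ (by simpa using h)
  | cons a t ih =>
    have ha := hl a List.mem_cons_self
    have ht : ∀ α ∈ t, α ∈ Δ := fun α hα => hl α (List.mem_cons_of_mem a hα)
    rw [List.map_cons, List.prod_cons] at h ⊢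
    rw [LinearIsometryEquiv.coe_mul, Function.comp_apply] at h
    by_cases hγ : (t.map refl).prod β ∈ posRoots R z
    · have hγa : (t.map refl).prod β = a := by
        by_contra hne
        exact h (hΔ.refl_mem_posRoots hR hz ha hγ hne)
      refine ⟨t, ht, List.length_cons.symm, ?_⟩
      rw [← hγa, refl_map _ β, inv_mul_cancel_right, mul_assoc, refl_mul_self, mul_one]
    · obtain ⟨t', ht', hlen, hprod⟩ := ih ht hγ
      refine ⟨a :: t', fun α hα => ?_, by simp [hlen], ?_⟩
      · rcases List.mem_cons.1 hα with rfl | hα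
        · exact ha
        · exact ht' α hα
      · rw [mul_assoc, hprod, List.map_cons, List.prod_cons]

lemma IsSimpleSystem.inner_word_le (hΔ : IsSimpleSystem R z Δ) (hR : IsNormalizedRootSystem R)
    (hz : ∀ α ∈ R, ⟪z, α⟫ ≠ 0) {x u : EuclideanSpace ℝ (Fin N)}
    (hx : ∀ α ∈ posRoots R z, 0 ≤ ⟪x, α⟫) (hu : ∀ α ∈ posRoots R z, 0 ≤ ⟪u, α⟫)
    (l : List (EuclideanSpace ℝ (Fin N))) (hl : ∀ α ∈ l, α ∈ Δ) :
    ⟪x, (l.map refl).prod u⟫ ≤ ⟪x, u⟫ := by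
  induction hn : l.length using Nat.strong_induction_on generalizing l with
  | _ n ih =>
    subst hn
    rcases l.eq_nil_or_concat' with rfl | ⟨t, a, rfl⟩
    · simp
    have ht : ∀ α ∈ t, α ∈ Δ := fun α hα => hl α (List.mem_append_left _ hα)
    have haP := hΔ.mem_posRoots (hl a (by simp))
    by_cases hta : (t.map refl).prod a ∈ posRoots R z
    · have := ih t.length (by simp) t ht rfl
      rw [List.map_append, List.prod_append, List.map_singleton, List.prod_singleton,
        LinearIsometryEquiv.coe_mul, Function.comp_apply, refl_apply_root hR (ReflectionGroup.mem_posRoots.1 haP).1,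
        map_sub, map_smul, inner_sub_right, inner_smul_right]
      linarith [mul_nonneg (hu a haP) (hx _ hta)]
    · obtain ⟨t', ht', hlen, hprod⟩ := hΔ.exchange hR hz haP t ht hta
      rw [List.map_append, List.prod_append, List.map_singleton, List.prod_singleton, hprod]
      exact ih t'.length (by simp; omega) t' ht' rfl

/-- On a closed chamber, the inner product is maximal among representatives of the orbits. -/
lemma inner_apply_le_of_mem_reflGroup (hR : IsNormalizedRootSystem R)
    (hz : ∀ α ∈ R, ⟪z, α⟫ ≠ 0) {x u : EuclideanSpace ℝ (Fin N)}
    (hx : ∀ α ∈ R, 0 ≤ ⟪x, α⟫ * ⟪z, α⟫) (hu : ∀ α ∈ R, 0 ≤ ⟪u, α⟫ * ⟪z, α⟫)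
    {g : EuclideanSpace ℝ (Fin N) ≃ₗᵢ[ℝ] EuclideanSpace ℝ (Fin N)} (hg : g ∈ reflGroup R) :
    ⟪x, g u⟫ ≤ ⟪x, u⟫ := by
  obtain ⟨Δ, hΔ⟩ := exists_isSimpleSystem R z
  obtain ⟨l, hl, rfl⟩ := hΔ.exists_word hR hz hg
  refine hΔ.inner_word_le hR hz (fun α hα => ?_) (fun α hα => ?_) l hl
  · exact nonneg_of_mul_nonneg_left (hx α (mem_posRoots.1 hα).1) (mem_posRoots.1 hα).2
  · exact nonneg_of_mul_nonneg_left (hu α (mem_posRoots.1 hα).1) (mem_posRoots.1 hα).2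

lemma connectedComponentIn_regular (hz : ∀ α ∈ R, ⟪z, α⟫ ≠ 0) :
    connectedComponentIn {v : EuclideanSpace ℝ (Fin N) | ∀ α ∈ R, ⟪v, α⟫ ≠ 0} z =
      {v | ∀ α ∈ R, 0 < ⟪v, α⟫ * ⟪z, α⟫} := by
  apply Set.Subset.antisymm
  · intro v hv α hα
    have hsub := connectedComponentIn_subset
      {v : EuclideanSpace ℝ (Fin N) | ∀ α ∈ R, ⟪v, α⟫ ≠ 0} z
    by_contra hneg
    have hcont : ContinuousOn (fun w : EuclideanSpace ℝ (Fin N) => ⟪w, α⟫ * ⟪z, α⟫)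
        (connectedComponentIn {v : EuclideanSpace ℝ (Fin N) | ∀ α ∈ R, ⟪v, α⟫ ≠ 0} z) :=
      Continuous.continuousOn (by fun_prop)
    obtain ⟨w, hw, hw0⟩ := isPreconnected_connectedComponentIn.intermediate_value hv
      (mem_connectedComponentIn hz) hcont ⟨not_lt.1 hneg, mul_self_nonneg _⟩
    exact mul_ne_zero (hsub hw α hα) (hz α hα) hw0
  · refine IsPreconnected.subset_connectedComponentIn (Convex.isPreconnected ?_)
      (fun α hα => mul_self_pos.2 (hz α hα))
      fun v hv α hα => left_ne_zero_of_mul (hv α hα).ne'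
    intro v hv w hw a b ha hb hab α hα
    rw [inner_add_left, real_inner_smul_left, real_inner_smul_left]
    have h1 := mul_nonneg ha (hv α hα).le
    have h2 := mul_nonneg hb (hw α hα).le
    rcases ha.eq_or_lt with rfl | ha
    · have := mul_pos (by linarith : 0 < b) (hw α hα)
      linarith
    · have := mul_pos ha (hv α hα)
      linarith

lemma mem_closure_chamber_iff (hz : ∀ α ∈ R, ⟪z, α⟫ ≠ 0) {x : EuclideanSpace ℝ (Fin N)} :
    x ∈ closure (connectedComponentIn
        {v : EuclideanSpace ℝ (Fin N) | ∀ α ∈ R, ⟪v, α⟫ ≠ 0} z) ↔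
      ∀ α ∈ R, 0 ≤ ⟪x, α⟫ * ⟪z, α⟫ := by
  rw [connectedComponentIn_regular hz]
  constructor
  · intro hx α hα
    have hcl : IsClosed {v : EuclideanSpace ℝ (Fin N) | 0 ≤ ⟪v, α⟫ * ⟪z, α⟫} :=
      isClosed_le continuous_const (by fun_prop)
    exact closure_minimal (fun v hv => (hv α hα).le) hcl hx
  · intro hx
    have hlim : Tendsto (fun t : ℝ => x + t • z) (𝓝[>] 0) (𝓝 x) := by
      have : Continuous fun t : ℝ => x + t • z := by fun_prop
      simpa using (this.tendsto 0).mono_left nhdsWithin_le_nhds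
    refine mem_closure_of_tendsto hlim ?_
    filter_upwards [self_mem_nhdsWithin] with t ht α hα
    rw [inner_add_left, real_inner_smul_left, add_mul, mul_assoc]
    exact add_pos_of_nonneg_of_pos (hx α hα) (mul_pos ht (mul_self_pos.2 (hz α hα)))

lemma exists_regular (hR : IsNormalizedRootSystem R) :
    ∃ z : EuclideanSpace ℝ (Fin N), ∀ α ∈ R, ⟪z, α⟫ ≠ 0 := by
  obtain ⟨z, -, hz⟩ := Module.Dual.exists_forall_mem_ne_zero_of_forall_exists
    (ι := R) (⊤ : Submodule ℝ (EuclideanSpace ℝ (Fin N)))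
    (fun α => (innerₛₗ ℝ α.1 : EuclideanSpace ℝ (Fin N) →ₗ[ℝ] ℝ))
    (fun α => ⟨α.1, trivial, by
      rw [innerₛₗ_apply_apply, inner_self_eq_two hR α.2]
      norm_num⟩)
  refine ⟨z, fun α hα => ?_⟩
  rw [real_inner_comm]
  exact hz ⟨α, hα⟩

/-- Two vectors which no root hyperplane separates lie in a common closed chamber. -/
lemma exists_common_chamber (hR : IsNormalizedRootSystem R) {x u : EuclideanSpace ℝ (Fin N)}
    (h : ∀ α ∈ R, 0 ≤ ⟪x, α⟫ * ⟪u, α⟫) :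
    ∃ z : EuclideanSpace ℝ (Fin N), (∀ α ∈ R, ⟪z, α⟫ ≠ 0) ∧
      (∀ α ∈ R, 0 ≤ ⟪x, α⟫ * ⟪z, α⟫) ∧ ∀ α ∈ R, 0 ≤ ⟪u, α⟫ * ⟪z, α⟫ := by
  obtain ⟨w, hw⟩ := exists_regular hR
  have hev : ∀ α ∈ R, ∀ᶠ t : ℝ in 𝓝[>] 0, ⟪x + u + t • w, α⟫ ≠ 0 ∧
      0 ≤ ⟪x, α⟫ * ⟪x + u + t • w, α⟫ ∧ 0 ≤ ⟪u, α⟫ * ⟪x + u + t • w, α⟫ := by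
    intro α hα
    have hxu := h α hα
    by_cases h0 : ⟪x + u, α⟫ = 0
    · filter_upwards [self_mem_nhdsWithin] with t ht
      have hne : t * ⟪w, α⟫ ≠ 0 := mul_ne_zero (ne_of_gt ht) (hw α hα)
      rw [inner_add_left] at h0
      have hx0 : ⟪x, α⟫ = 0 := by nlinarith
      have hu0 : ⟪u, α⟫ = 0 := by linarith
      simpa [inner_add_left, real_inner_smul_left, hx0, hu0] using hne
    · have hcont : Continuous fun t : ℝ => ⟪x + u + t • w, α⟫ * ⟪x + u, α⟫ := by fun_prop
      have hpos := (hcont.tendsto 0).eventually_const_lt (u := 0)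
        (by simpa using mul_self_pos.2 h0)
      filter_upwards [nhdsWithin_le_nhds hpos] with t ht
      have h1 : 0 ≤ ⟪x, α⟫ * ⟪x + u, α⟫ := by
        rw [inner_add_left]
        nlinarith [mul_self_nonneg ⟪x, α⟫]
      have h2 : 0 ≤ ⟪u, α⟫ * ⟪x + u, α⟫ := by
        rw [inner_add_left]
        nlinarith [mul_self_nonneg ⟪u, α⟫]
      have hsq := mul_self_pos.2 h0
      refine ⟨left_ne_zero_of_mul ht.ne', ?_, ?_⟩
      · refine nonneg_of_mul_nonneg_left (b := ⟪x + u, α⟫ * ⟪x + u, α⟫) ?_ hsq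
        nlinarith [mul_nonneg h1 ht.le]
      · refine nonneg_of_mul_nonneg_left (b := ⟪x + u, α⟫ * ⟪x + u, α⟫) ?_ hsq
        nlinarith [mul_nonneg h2 ht.le]
  obtain ⟨t, ht⟩ := ((Filter.eventually_all_finset R).2 hev).exists
  exact ⟨_, fun α hα => (ht α hα).1, fun α hα => (ht α hα).2.1, fun α hα => (ht α hα).2.2⟩

lemma norm_sub_le_norm_sub_iff {x u v : EuclideanSpace ℝ (Fin N)} (huv : ‖v‖ = ‖u‖) :
    ‖x - u‖ ≤ ‖x - v‖ ↔ ⟪x, v⟫ ≤ ⟪x, u⟫ := by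
  rw [← sq_le_sq₀ (norm_nonneg _) (norm_nonneg _), norm_sub_sq_real, norm_sub_sq_real, huv]
  constructor <;> intro h <;> linarith

lemma orbitDist_eq_iff_forall_inner_le {x y : EuclideanSpace ℝ (Fin N)}
    {σ : EuclideanSpace ℝ (Fin N) ≃ₗᵢ[ℝ] EuclideanSpace ℝ (Fin N)} (hσ : σ ∈ reflGroup R) :
    orbitDist R x y = ‖x - σ y‖ ↔ ∀ g ∈ reflGroup R, ⟪x, g (σ y)⟫ ≤ ⟪x, σ y⟫ := by
  have hbdd : BddBelow {r | ∃ σ ∈ reflGroup R, r = ‖x - σ y‖} := by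
    refine ⟨0, ?_⟩
    rintro _ ⟨τ, -, rfl⟩
    exact norm_nonneg _
  constructor
  · intro h g hg
    rw [← norm_sub_le_norm_sub_iff (g.norm_map _), ← h]
    exact csInf_le hbdd ⟨g * σ, mul_mem hg hσ, rfl⟩
  · intro h
    refine IsLeast.csInf_eq ⟨⟨σ, hσ, rfl⟩, ?_⟩
    rintro _ ⟨τ, hτ, rfl⟩
    have := h (τ * σ⁻¹) (mul_mem hτ (inv_mem hσ))
    rw [← norm_sub_le_norm_sub_iff (LinearIsometryEquiv.norm_map _ _),
      ← Function.comp_apply (f := τ * σ⁻¹), ← LinearIsometryEquiv.coe_mul, inv_mul_cancel_right] at this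
    exact this

end

end ReflectionGroup

/-- `d(x,y) = ‖x − σ(y)‖` if and only if `x` and `σ(y)` lie in a common closed Weyl chamber,
i.e. in the closure of a common connected component of
`{v : ⟨v,α⟩ ≠ 0 for all α ∈ R}`. -/
theorem orbitDist_eq_iff_common_chamber {N : ℕ} (hN : 1 ≤ N)
    (R : Finset (EuclideanSpace ℝ (Fin N))) (hR : IsNormalizedRootSystem R)
    (x y : EuclideanSpace ℝ (Fin N))
    (σ : EuclideanSpace ℝ (Fin N) ≃ₗᵢ[ℝ] EuclideanSpace ℝ (Fin N)) (hσ : σ ∈ reflGroup R) :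
    orbitDist R x y = ‖x - σ y‖ ↔
      ∃ z : EuclideanSpace ℝ (Fin N), (∀ α ∈ R, ⟪z, α⟫ ≠ 0) ∧
        x ∈ closure (connectedComponentIn {v : EuclideanSpace ℝ (Fin N) | ∀ α ∈ R, ⟪v, α⟫ ≠ 0} z) ∧
        σ y ∈ closure (connectedComponentIn {v : EuclideanSpace ℝ (Fin N) | ∀ α ∈ R, ⟪v, α⟫ ≠ 0} z) := by
  rw [ReflectionGroup.orbitDist_eq_iff_forall_inner_le hσ]
  constructor
  · intro h
    have hsep : ∀ α ∈ R, 0 ≤ ⟪x, α⟫ * ⟪σ y, α⟫ := fun α hα => by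
      have := h _ (ReflectionGroup.refl_mem_reflGroup hα)
      rw [ReflectionGroup.refl_apply_root hR hα, inner_sub_right, inner_smul_right] at this
      linarith
    obtain ⟨z, hz, hxz, huz⟩ := ReflectionGroup.exists_common_chamber hR hsep
    exact ⟨z, hz, (ReflectionGroup.mem_closure_chamber_iff hz).2 hxz,
      (ReflectionGroup.mem_closure_chamber_iff hz).2 huz⟩
  · rintro ⟨z, hz, hx, hu⟩ g hg
    exact ReflectionGroup.inner_apply_le_of_mem_reflGroup hR hz
      ((ReflectionGroup.mem_closure_chamber_iff hz).1 hx)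
      ((ReflectionGroup.mem_closure_chamber_iff hz).1 hu) hg

end
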